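/- arXiv:2302.05935 — 4 statements merged into one kernel-verified Lean document; each statement's English description precedes it below -/
import Mathlib

section
/- Let $X\subseteq\mathbb{R}^n$ and $Y\subseteq\mathbb{R}^m$ be nonempty closed convex sets and let $f:\mathbb{R}^n\times\mathbb{R}^m\to\mathbb{R}$ be continuously differentiable on a neighborhood of $X\times Y$. If $(\hat{x},\hat{y})\in X\times Y$ is a local minimax point of $\min_{x\in X}\max_{y\in Y} f(x,y)$, then $\langle \nabla_x f(\hat{x},\hat{y}),\, x-\hat{x}\rangle \ge 0$ for all $x\in X$ and $\langle \nabla_y f(\hat{x},\hat{y}),\, y-\hat{y}\rangle \le 0$ for all $y\in Y$. -/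
open RealInnerProductSpace

/-- A local minimax point of `min_{x ∈ X} max_{y ∈ Y} f (x, y)`. -/
def IsLocalMinimax {n m : ℕ} (X : Set (EuclideanSpace ℝ (Fin n)))
    (Y : Set (EuclideanSpace ℝ (Fin m)))
    (f : EuclideanSpace ℝ (Fin n) × EuclideanSpace ℝ (Fin m) → ℝ)
    (xh : EuclideanSpace ℝ (Fin n)) (yh : EuclideanSpace ℝ (Fin m)) : Prop :=
  xh ∈ X ∧ yh ∈ Y ∧
  ∃ δ₀ > (0:ℝ), ∃ τ : ℝ → ℝ, (∀ δ, 0 ≤ τ δ) ∧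
    Filter.Tendsto τ (nhdsWithin 0 (Set.Ioi 0)) (nhds 0) ∧
    ∀ δ ∈ Set.Ioc (0:ℝ) δ₀, ∀ x ∈ X, ∀ y ∈ Y,
      ‖x - xh‖ ≤ δ → ‖y - yh‖ ≤ δ →
        f (xh, y) ≤ f (xh, yh) ∧
        ∃ y' ∈ Y, ‖y' - yh‖ ≤ τ δ ∧ f (xh, yh) ≤ f (x, y')

/-- If `f` has strict derivative `L` at `(a, b)` and, arbitrarily close to `(a, b)`, moving the
first argument along `v` from `a` does not decrease `f` for some fixed second argument, then
`L (v, 0)` is nonnegative. -/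
theorem HasStrictFDerivAt.nonneg_of_frequently {E F : Type*} [NormedAddCommGroup E]
    [NormedSpace ℝ E] [NormedAddCommGroup F] [NormedSpace ℝ F] {f : E × F → ℝ}
    {L : E × F →L[ℝ] ℝ} {a v : E} {b : F} (hf : HasStrictFDerivAt f L (a, b))
    (h : ∀ η > 0, ∃ s > (0 : ℝ), ∃ y, ‖s • v‖ < η ∧ ‖y - b‖ < η ∧
      f (a, y) ≤ f (a + s • v, y)) :
    0 ≤ L (v, 0) := by
  refine le_of_forall_pos_le_add fun ε hε => ?_
  have hc : 0 < ε / (‖v‖ + 1) := by positivity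
  obtain ⟨η, hη, hball⟩ := Metric.eventually_nhds_iff.1 (hf.isLittleO.def hc)
  obtain ⟨s, hs, y, hsv, hy, hle⟩ := h η hη
  have hbound := @hball ((a + s • v, y), (a, y)) (by
    simp [dist_eq_norm, hsv, hy])
  have hsub : ((a + s • v, y) - (a, y) : E × F) = s • (v, 0) := by simp
  simp only [hsub, map_smul, norm_smul, smul_eq_mul, Prod.norm_mk, norm_zero,
    Real.norm_eq_abs, _root_.abs_of_pos hs, max_eq_left (norm_nonneg v)] at hbound
  have hv : ε / (‖v‖ + 1) * ‖v‖ ≤ ε := by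
    rw [div_mul_eq_mul_div, div_le_iff₀ (by positivity)]
    nlinarith [norm_nonneg v]
  have := (abs_le.1 hbound).2
  by_contra! hneg
  nlinarith [mul_le_mul_of_nonneg_left hv hs.le, mul_pos hs (sub_pos.2 hneg)]

/-- First-order necessary optimality conditions at a local minimax point. -/
theorem stmt_0 {n m : ℕ} (X : Set (EuclideanSpace ℝ (Fin n)))
    (Y : Set (EuclideanSpace ℝ (Fin m)))
    (hX : X.Nonempty) (hXc : IsClosed X) (hXconv : Convex ℝ X)
    (hY : Y.Nonempty) (hYc : IsClosed Y) (hYconv : Convex ℝ Y)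
    (f : EuclideanSpace ℝ (Fin n) × EuclideanSpace ℝ (Fin m) → ℝ)
    (U : Set (EuclideanSpace ℝ (Fin n) × EuclideanSpace ℝ (Fin m)))
    (hUopen : IsOpen U) (hXYU : X ×ˢ Y ⊆ U) (hf : ContDiffOn ℝ 1 f U)
    (xh : EuclideanSpace ℝ (Fin n)) (yh : EuclideanSpace ℝ (Fin m))
    (hmm : IsLocalMinimax X Y f xh yh) :
    (∀ x ∈ X, 0 ≤ ⟪gradient (fun x' => f (x', yh)) xh, x - xh⟫) ∧
    (∀ y ∈ Y, ⟪gradient (fun y' => f (xh, y')) yh, y - yh⟫ ≤ 0) := by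
  obtain ⟨hx, hy, δ₀, hδ₀, τ, -, hτ, hloc⟩ := hmm
  have hmax : ∀ y ∈ Y, ‖y - yh‖ ≤ δ₀ → f (xh, y) ≤ f (xh, yh) := fun y hyY hyδ =>
    (hloc δ₀ ⟨hδ₀, le_rfl⟩ xh hx y hyY (by simpa using hδ₀.le) hyδ).1
  have hL : HasStrictFDerivAt f (fderiv ℝ f (xh, yh)) (xh, yh) :=
    (hf.contDiffAt (hUopen.mem_nhds (hXYU ⟨hx, hy⟩))).hasStrictFDerivAt one_ne_zero
  set L := fderiv ℝ f (xh, yh)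
  have hLx : HasFDerivAt (fun x' => f (x', yh)) (L.comp (.inl ℝ _ _)) xh :=
    HasFDerivAt.comp (g := f) xh hL.hasFDerivAt (hasFDerivAt_prodMk_left xh yh)
  have hLy : HasFDerivAt (fun y' => f (xh, y')) (L.comp (.inr ℝ _ _)) yh :=
    HasFDerivAt.comp (g := f) yh hL.hasFDerivAt (hasFDerivAt_prodMk_right xh yh)
  constructor
  · intro x hxX
    rw [gradient, hLx.fderiv, InnerProductSpace.toDual_symm_apply]
    refine hL.nonneg_of_frequently (v := x - xh) fun η hη => ?_
    have hτ_small : ∀ᶠ δ in nhdsWithin 0 (Set.Ioi 0), τ δ < min η δ₀ :=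
      hτ.eventually_lt_const (lt_min hη hδ₀)
    have hδ_small : ∀ᶠ δ in nhdsWithin (0 : ℝ) (Set.Ioi 0),
        δ ∈ Set.Ioo 0 (min η (min δ₀ 1)) :=
      Ioo_mem_nhdsGT (lt_min hη (lt_min hδ₀ one_pos))
    obtain ⟨δ, hτδ, hδ, hδlt⟩ := (hτ_small.and hδ_small).exists
    obtain ⟨hτη, hτδ₀⟩ := lt_min_iff.1 hτδ
    obtain ⟨hδη, hδlt⟩ := lt_min_iff.1 hδlt
    obtain ⟨hδδ₀, hδ1⟩ := lt_min_iff.1 hδlt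
    set s := δ / (‖x - xh‖ + 1)
    have hs : 0 < s := by positivity
    have hmul : s * (‖x - xh‖ + 1) = δ := div_mul_cancel₀ _ (by positivity)
    have hnonneg : 0 ≤ s * ‖x - xh‖ := by positivity
    have hnorm : ‖s • (x - xh)‖ ≤ δ := by
      rw [norm_smul, Real.norm_eq_abs, abs_of_pos hs]
      linarith
    obtain ⟨-, y', hy'Y, hy'τ, hle⟩ := hloc δ ⟨hδ, hδδ₀.le⟩ (xh + s • (x - xh))
      (hXconv.add_smul_sub_mem hx hxX ⟨hs.le, by linarith⟩) yh hy (by simpa using hnorm)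
      (by simpa using hδ.le)
    exact ⟨s, hs, y', hnorm.trans_lt hδη, hy'τ.trans_lt hτη,
      (hmax y' hy'Y (hy'τ.trans hτδ₀.le)).trans hle⟩
  · intro y hyY
    rw [gradient, hLy.fderiv, InnerProductSpace.toDual_symm_apply]
    have hlocal : IsLocalMaxOn (fun y' => f (xh, y')) Y yh := by
      filter_upwards [self_mem_nhdsWithin,
        mem_nhdsWithin_of_mem_nhds (Metric.closedBall_mem_nhds yh hδ₀)] with z hz hzδ
      exact hmax z hz (by simpa [dist_eq_norm] using hzδ)
    exact hlocal.hasFDerivWithinAt_nonpos hLy.hasFDerivWithinAt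
      (sub_mem_posTangentConeAt_of_segment_subset (hYconv.segment_subset hy hyY))
end

section
/- Let $X\subseteq\mathbb{R}^n$ and $Y\subseteq\mathbb{R}^m$ be nonempty compact sets, let $f:X\times Y\to\mathbb{R}$ be continuous, and let $f_N:X\times Y\to\mathbb{R}$, $N\in\mathbb{N}$, be continuous functions with $\sup_{(x,y)\in X\times Y}|f_N(x,y)-f(x,y)|\to 0$ as $N\to\infty$. If $(x^N,y^N)$ is a global minimax point of $\min_{x\in X}\max_{y\in Y} f_N(x,y)$ for each $N$ and $(x^N,y^N)\to(\bar{x},\bar{y})$, then $(\bar{x},\bar{y})$ is a global minimax point of $\min_{x\in X}\max_{y\in Y} f(x,y)$. -/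
/-- A point `(xh, yh)` is a global minimax point of `min_{x ∈ X} max_{y ∈ Y} g x y`. -/
def IsGlobalMinimax {n m : ℕ} (X : Set (EuclideanSpace ℝ (Fin n)))
    (Y : Set (EuclideanSpace ℝ (Fin m)))
    (g : EuclideanSpace ℝ (Fin n) → EuclideanSpace ℝ (Fin m) → ℝ)
    (xh : EuclideanSpace ℝ (Fin n)) (yh : EuclideanSpace ℝ (Fin m)) : Prop :=
  xh ∈ X ∧ yh ∈ Y ∧ ∀ x ∈ X, ∀ y ∈ Y,
    g xh y ≤ g xh yh ∧ g xh yh ≤ sSup (g x '' Y)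

/-- Limits of global minimax points of uniformly convergent problems are global
minimax points of the limit problem. -/
theorem stmt_4 {n m : ℕ} (X : Set (EuclideanSpace ℝ (Fin n)))
    (Y : Set (EuclideanSpace ℝ (Fin m)))
    (hX : X.Nonempty) (hXc : IsCompact X)
    (hY : Y.Nonempty) (hYc : IsCompact Y)
    (f : EuclideanSpace ℝ (Fin n) → EuclideanSpace ℝ (Fin m) → ℝ)
    (fN : ℕ → EuclideanSpace ℝ (Fin n) → EuclideanSpace ℝ (Fin m) → ℝ)
    (hf : ContinuousOn (fun p => f p.1 p.2) (X ×ˢ Y))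
    (hfN : ∀ N, ContinuousOn (fun p => fN N p.1 p.2) (X ×ˢ Y))
    (hunif : TendstoUniformlyOn (fun N p => fN N p.1 p.2) (fun p => f p.1 p.2)
      Filter.atTop (X ×ˢ Y))
    (xN : ℕ → EuclideanSpace ℝ (Fin n)) (yN : ℕ → EuclideanSpace ℝ (Fin m))
    (hminimax : ∀ N, IsGlobalMinimax X Y (fN N) (xN N) (yN N))
    (xbar : EuclideanSpace ℝ (Fin n)) (ybar : EuclideanSpace ℝ (Fin m))
    (hconv : Filter.Tendsto (fun N => (xN N, yN N)) Filter.atTop (nhds (xbar, ybar))) :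
    IsGlobalMinimax X Y f xbar ybar := by
  have hmem : ∀ N, (xN N, yN N) ∈ X ×ˢ Y := fun N => ⟨(hminimax N).1, (hminimax N).2.1⟩
  have hbar : (xbar, ybar) ∈ X ×ˢ Y :=
    (hXc.prod hYc).isClosed.mem_of_tendsto hconv (Filter.Eventually.of_forall hmem)
  have hlim : Filter.Tendsto (fun N => fN N (xN N) (yN N)) Filter.atTop
      (nhds (f xbar ybar)) :=
    hunif.tendsto_comp (hf _ hbar)
      (tendsto_nhdsWithin_iff.2 ⟨hconv, Filter.Eventually.of_forall hmem⟩)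
  refine ⟨hbar.1, hbar.2, fun x hx y hy => ⟨?_, ?_⟩⟩
  · have hconv' : Filter.Tendsto (fun N => (xN N, y)) Filter.atTop (nhds (xbar, y)) :=
      hconv.fst_nhds.prodMk_nhds tendsto_const_nhds
    have hlim' : Filter.Tendsto (fun N => fN N (xN N) y) Filter.atTop (nhds (f xbar y)) :=
      hunif.tendsto_comp (hf (xbar, y) ⟨hbar.1, hy⟩)
        (tendsto_nhdsWithin_iff.2
          ⟨hconv', Filter.Eventually.of_forall fun N => ⟨(hmem N).1, hy⟩⟩)
    exact le_of_tendsto_of_tendsto' hlim' hlim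
      fun N => ((hminimax N).2.2 x hx y hy).1
  · have hcont : ContinuousOn (f x) Y :=
      hf.comp (f := fun y => (x, y)) (by fun_prop) fun y hy => ⟨hx, hy⟩
    have hbdd : BddAbove (f x '' Y) := (hYc.image_of_continuousOn hcont).bddAbove
    refine le_of_forall_pos_le_add fun ε hε => le_of_tendsto hlim ?_
    filter_upwards [Metric.tendstoUniformlyOn_iff.1 hunif ε hε] with N hN
    refine ((hminimax N).2.2 x hx y hy).2.trans (csSup_le (hY.image _) ?_)
    rintro _ ⟨z, hz, rfl⟩
    have hclose := hN (x, z) ⟨hx, hz⟩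
    rw [Real.dist_eq] at hclose
    linarith [(abs_lt.1 hclose).1, le_csSup hbdd (Set.mem_image_of_mem (f x) hz)]
end

section
/- Let $l<u$ be real numbers and let $0<\mu\le u-l$. For $s\in\mathbb{R}$ define $h(s,\mu)=\int_{-1/2}^{1/2}\mathrm{mid}(l,u,s-\mu t)\,dt$ (smoothing with the uniform density on $[-\tfrac12,\tfrac12]$). Then: (i) if $|u-s|\le \mu/2$, $h(s,\mu)=\tfrac{s+u}{2}-\tfrac{(u-s)^2}{2\mu}-\tfrac{\mu}{8}$; (ii) if $|l-s|\le \mu/2$, $h(s,\mu)=\tfrac{s+l}{2}+\tfrac{(s-l)^2}{2\mu}+\tfrac{\mu}{8}$; (iii) otherwise, $h(s,\mu)=\mathrm{mid}(l,u,s)$. -/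
/-- The middle (truncation) operator `mid (l, u, t)`. -/
def midOp (l u t : ℝ) : ℝ := max l (min u t)

lemma midOp_of_le {l u x : ℝ} (hlu : l ≤ u) (hx : x ≤ l) : midOp l u x = l := by
  rw [midOp, min_eq_right (hx.trans hlu), max_eq_left hx]

lemma midOp_of_ge {l u x : ℝ} (hlu : l ≤ u) (hx : u ≤ x) : midOp l u x = u := by
  rw [midOp, min_eq_left hx, max_eq_right hlu]

lemma midOp_of_mem {l u x : ℝ} (hl : l ≤ x) (hu : x ≤ u) : midOp l u x = x := by
  rw [midOp, min_eq_right hu, max_eq_right hl]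

lemma intervalIntegrable_midOp (l u s μ a b : ℝ) :
    IntervalIntegrable (fun t => midOp l u (s - μ * t)) MeasureTheory.volume a b := by
  apply Continuous.intervalIntegrable
  unfold midOp
  fun_prop

lemma integral_eq_mul_of_eqOn_Icc {f : ℝ → ℝ} {a b c : ℝ} (hab : a ≤ b)
    (hf : ∀ t ∈ Set.Icc a b, f t = c) : ∫ t in a..b, f t = c * (b - a) := by
  rw [intervalIntegral.integral_congr (g := fun _ => c)
    (by rwa [Set.uIcc_of_le hab]), intervalIntegral.integral_const, smul_eq_mul, mul_comm]

lemma integral_midOp_of_mem {l u s μ a b : ℝ} (hab : a ≤ b)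
    (hf : ∀ t ∈ Set.Icc a b, l ≤ s - μ * t ∧ s - μ * t ≤ u) :
    ∫ t in a..b, midOp l u (s - μ * t) = s * (b - a) - μ * ((b ^ 2 - a ^ 2) / 2) := by
  rw [intervalIntegral.integral_congr (g := fun t => s - μ * t)]
  · rw [intervalIntegral.integral_sub (by simp)
      (Continuous.intervalIntegrable (by fun_prop) _ _), intervalIntegral.integral_const_mul,
      integral_id, intervalIntegral.integral_const, smul_eq_mul, mul_comm s]
  · intro t ht
    rw [Set.uIcc_of_le hab] at ht
    exact midOp_of_mem (hf t ht).1 (hf t ht).2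

/-- Explicit formula for the smoothing of the middle operator with the uniform density
on `[-1/2, 1/2]` and smoothing parameter `0 < μ ≤ u - l`. -/
theorem stmt_10 (l u : ℝ) (hlu : l < u) (μ : ℝ) (hμ0 : 0 < μ) (hμ : μ ≤ u - l)
    (h : ℝ → ℝ) (hh : ∀ s, h s = ∫ t in (-(1:ℝ)/2)..(1/2), midOp l u (s - μ * t)) :
    (∀ s : ℝ, |u - s| ≤ μ / 2 →
        h s = (s + u) / 2 - (u - s) ^ 2 / (2 * μ) - μ / 8) ∧
    (∀ s : ℝ, |l - s| ≤ μ / 2 →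
        h s = (s + l) / 2 + (s - l) ^ 2 / (2 * μ) + μ / 8) ∧
    (∀ s : ℝ, ¬ (|u - s| ≤ μ / 2) → ¬ (|l - s| ≤ μ / 2) →
        h s = midOp l u s) := by
  refine ⟨fun s hs => ?_, fun s hs => ?_, fun s hsu hsl => ?_⟩
  · obtain ⟨h1, h2⟩ := abs_le.mp hs
    obtain ⟨a, rfl⟩ : ∃ a, s = u + μ * a := ⟨(s - u) / μ, by field_simp; ring⟩
    have ha1 : -(1:ℝ) / 2 ≤ a := by nlinarith
    have ha2 : a ≤ 1 / 2 := by nlinarith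
    rw [hh, ← intervalIntegral.integral_add_adjacent_intervals
      (intervalIntegrable_midOp l u _ μ _ a) (intervalIntegrable_midOp l u _ μ a _),
      integral_eq_mul_of_eqOn_Icc (c := u) ha1, integral_midOp_of_mem ha2]
    · field_simp
      ring
    · rintro t ⟨h3, h4⟩
      constructor <;> nlinarith
    · rintro t ⟨h3, h4⟩
      exact midOp_of_ge hlu.le (by nlinarith)
  · obtain ⟨h1, h2⟩ := abs_le.mp hs
    obtain ⟨a, rfl⟩ : ∃ a, s = l + μ * a := ⟨(s - l) / μ, by field_simp; ring⟩
    have ha1 : -(1:ℝ) / 2 ≤ a := by nlinarith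
    have ha2 : a ≤ 1 / 2 := by nlinarith
    rw [hh, ← intervalIntegral.integral_add_adjacent_intervals
      (intervalIntegrable_midOp l u _ μ _ a) (intervalIntegrable_midOp l u _ μ a _),
      integral_midOp_of_mem ha1, integral_eq_mul_of_eqOn_Icc (c := l) ha2]
    · field_simp
      ring
    · rintro t ⟨h3, h4⟩
      exact midOp_of_le hlu.le (by nlinarith)
    · rintro t ⟨h3, h4⟩
      constructor <;> nlinarith
  · rw [not_le, lt_abs] at hsu hsl
    rw [hh]
    have hle : -(1:ℝ) / 2 ≤ 1 / 2 := by norm_num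
    rcases hsl with hsl | hsl
    · rw [midOp_of_le hlu.le (by linarith), integral_eq_mul_of_eqOn_Icc (c := l) hle]
      · ring
      · rintro t ⟨h3, h4⟩
        exact midOp_of_le hlu.le (by nlinarith)
    · rcases hsu with hsu | hsu
      · rw [midOp_of_mem (by linarith) (by linarith), integral_midOp_of_mem hle]
        · ring
        · rintro t ⟨h3, h4⟩
          constructor <;> nlinarith
      · rw [midOp_of_ge hlu.le (by linarith), integral_eq_mul_of_eqOn_Icc (c := u) hle]
        · ring
        · rintro t ⟨h3, h4⟩
          exact midOp_of_ge hlu.le (by nlinarith)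
end

section
/- Let $l<u$ be real numbers, $0<\mu\le u-l$, and define $h(s,\mu)=\int_{-1/2}^{1/2}\mathrm{mid}(l,u,s-\mu t)\,dt$ for $s\in\mathbb{R}$. Then for every $s\in\mathbb{R}$, $|h(s,\mu)-\mathrm{mid}(l,u,s)|\le \mu/8$. -/
theorem continuous_midOp (l u : ℝ) : Continuous (midOp l u) := by
  unfold midOp
  fun_prop

/-- Since `midOp l u` is monotone and nonexpansive, its symmetric second difference at step `a`
is at most `a`. -/
theorem abs_midOp_second_difference_le (l u s : ℝ) {a : ℝ} (ha : 0 ≤ a) :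
    |midOp l u (s - a) + midOp l u (s + a) - 2 * midOp l u s| ≤ a := by
  have increment : ∀ x, midOp l u x ≤ midOp l u (x + a) ∧
      midOp l u (x + a) ≤ midOp l u x + a := by
    intro x
    unfold midOp
    grind
  have left := increment (s - a)
  have right := increment s
  rw [sub_add_cancel] at left
  rw [abs_le]
  constructor <;> linarith

/-- The integral of a continuous function over a symmetric interval, folded onto its right half. -/
theorem integral_symm_eq_integral_add_comp_neg {f : ℝ → ℝ} (hf : Continuous f) (r : ℝ) :
    ∫ t in -r..r, f t = ∫ t in (0:ℝ)..r, (f t + f (-t)) := by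
  have hf_neg : Continuous fun t => f (-t) := hf.comp continuous_neg
  rw [intervalIntegral.integral_add (hf.intervalIntegrable _ _)
      (hf_neg.intervalIntegrable _ _),
    intervalIntegral.integral_comp_neg, neg_zero, add_comm,
    intervalIntegral.integral_add_adjacent_intervals (hf.intervalIntegrable _ _)
      (hf.intervalIntegrable _ _)]

/-- The smoothing of the middle operator with the uniform density on `[-1/2, 1/2]`
and smoothing parameter `0 < μ ≤ u - l` is within `μ / 8` of the middle operator. -/
theorem stmt_11 (l u : ℝ) (hlu : l < u) (μ : ℝ) (hμ0 : 0 < μ) (hμ : μ ≤ u - l)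
    (h : ℝ → ℝ) (hh : ∀ s, h s = ∫ t in (-(1:ℝ)/2)..(1/2), midOp l u (s - μ * t)) :
    ∀ s : ℝ, |h s - midOp l u s| ≤ μ / 8 := by
  intro s
  have hcont : Continuous fun t : ℝ => midOp l u (s - μ * t) :=
    (continuous_midOp l u).comp (by fun_prop)
  have hcont_neg : Continuous fun t : ℝ => midOp l u (s - μ * -t) :=
    hcont.comp continuous_neg
  have hcont_add : Continuous fun t : ℝ => midOp l u (s - μ * t) + midOp l u (s - μ * -t) :=
    hcont.add hcont_neg
  have key : h s - midOp l u s = ∫ t in (0:ℝ)..(1/2),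
      (midOp l u (s - μ * t) + midOp l u (s - μ * -t) - 2 * midOp l u s) := by
    rw [hh, neg_div, integral_symm_eq_integral_add_comp_neg hcont,
      intervalIntegral.integral_sub (hcont_add.intervalIntegrable _ _)
        intervalIntegrable_const, intervalIntegral.integral_const, smul_eq_mul]
    ring
  have hbound : ∫ t in (0:ℝ)..(1/2), μ * t = μ / 8 := by
    rw [intervalIntegral.integral_const_mul, integral_id]
    ring
  rw [key, ← hbound, ← Real.norm_eq_abs]
  refine intervalIntegral.norm_integral_le_of_norm_le (by norm_num)
    (Filter.Eventually.of_forall fun t ht => ?_)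
    ((continuous_const.mul continuous_id).intervalIntegrable _ _)
  rw [Real.norm_eq_abs, mul_neg, sub_neg_eq_add]
  exact abs_midOp_second_difference_le l u s (mul_nonneg hμ0.le ht.1.le)
end
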